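/- Let η > 0 and h ≥ 0, and define l : ℝ → ℝ by l(r) = r · (arctan(1/η) − arctan(√(r²(1 + η⁻²)/(4 + h + r²) − 1))). Then l(r) = O(1/r) as r → ∞; in particular, l(r) → 0 as r → ∞. -/

import Mathlib

open Filter Asymptotics

/-- The real arctangent is nonexpansive: its difference is at most that of the arguments. -/
theorem arctan_sub_arctan_le_sub {x y : ℝ} (hxy : x ≤ y) :
    Real.arctan y - Real.arctan x ≤ y - x := by
  have h := (convex_univ (𝕜 := ℝ) (E := ℝ)).image_sub_le_mul_sub_of_deriv_le (C := 1)
    Real.continuous_arctan.continuousOn Real.differentiable_arctan.differentiableOn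
    (fun t _ => by
      rw [Real.deriv_arctan]
      exact div_le_one_of_le₀ (by nlinarith [sq_nonneg t]) (by positivity))
    x (Set.mem_univ _) y (Set.mem_univ _) hxy
  simpa using h

theorem sub_sqrt_le_div {a s : ℝ} (ha : 0 < a) (hs : s ≤ a ^ 2) :
    a - √s ≤ (a ^ 2 - s) / a := by
  have hle : √s ≤ a := Real.sqrt_le_iff.2 ⟨ha.le, hs⟩
  have key : s ≤ √s * a := by
    rcases le_total s 0 with h0 | h0
    · exact h0.trans (by positivity)
    · nlinarith [Real.mul_self_sqrt h0, Real.sqrt_nonneg s]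
  rw [le_div_iff₀ ha]
  nlinarith

/-- The spherical distance function `l(r)` between the link of the cone
`𝒞_{v,η}` and the intersection of the sphere of radius `r` with the boundary
of the barrier set `E_{v,η,h}`. Writing `l(r) = r(arctan(1/η) −
arctan(√(r²(1 + η⁻²)/(4 + h + r²) − 1)))`, one has `l(r) = O(1/r)` as
`r → ∞`; in particular `l(r) → 0` as `r → ∞`. -/
theorem l_isBigO_one_div (η h : ℝ) (hη : 0 < η) (hh : 0 ≤ h) :
    (fun r : ℝ => r * (Real.arctan (1 / η) -
        Real.arctan (Real.sqrt (r ^ 2 * (1 + η⁻¹ ^ 2) / (4 + h + r ^ 2) - 1))))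
      =O[atTop] (fun r : ℝ => 1 / r) ∧
    Tendsto (fun r : ℝ => r * (Real.arctan (1 / η) -
        Real.arctan (Real.sqrt (r ^ 2 * (1 + η⁻¹ ^ 2) / (4 + h + r ^ 2) - 1))))
      atTop (nhds 0) := by
  have hO : (fun r : ℝ => r * (Real.arctan (1 / η) -
        Real.arctan (Real.sqrt (r ^ 2 * (1 + η⁻¹ ^ 2) / (4 + h + r ^ 2) - 1))))
      =O[atTop] (fun r : ℝ => 1 / r) := by
    have ha : 0 < η⁻¹ := inv_pos.2 hη
    rw [one_div η]
    generalize η⁻¹ = a at ha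
    refine IsBigO.of_bound ((1 + a ^ 2) * (4 + h) / a) ?_
    filter_upwards [eventually_gt_atTop 0] with r hr
    have hden : 0 < 4 + h + r ^ 2 := by positivity
    set s := r ^ 2 * (1 + a ^ 2) / (4 + h + r ^ 2) - 1 with hs_def
    have hs : a ^ 2 - s = (1 + a ^ 2) * (4 + h) / (4 + h + r ^ 2) := by
      rw [hs_def]
      field_simp
      ring
    have hsa : s ≤ a ^ 2 := by
      have : 0 ≤ (1 + a ^ 2) * (4 + h) / (4 + h + r ^ 2) := by positivity
      linarith
    have hle : √s ≤ a := Real.sqrt_le_iff.2 ⟨ha.le, hsa⟩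
    have hnonneg : 0 ≤ Real.arctan a - Real.arctan √s :=
      sub_nonneg.2 (Real.arctan_mono hle)
    rw [Real.norm_of_nonneg (mul_nonneg hr.le hnonneg), Real.norm_of_nonneg (by positivity)]
    calc r * (Real.arctan a - Real.arctan √s)
        ≤ r * ((1 + a ^ 2) * (4 + h) / (4 + h + r ^ 2) / a) := by
          rw [← hs]
          gcongr
          exact (arctan_sub_arctan_le_sub hle).trans (sub_sqrt_le_div ha hsa)
      _ ≤ r * ((1 + a ^ 2) * (4 + h) / r ^ 2 / a) := by
          gcongr
          linarith
      _ = (1 + a ^ 2) * (4 + h) / a * (1 / r) := by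
          field_simp
  exact ⟨hO, hO.trans_tendsto (by simpa using tendsto_inv_atTop_zero (𝕜 := ℝ))⟩
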